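/- Let A^E ∈ ℝ^{p×m}, b^E ∈ ℝ^p (all entries nonzero), A^I ∈ ℝ^{q×m}, b^I ∈ ℝ^q (all entries nonzero), and let C(0) = { x ≥ 0 : A^E x = b^E, A^I x ≤ b^I } be nonempty and bounded. Let x* maximize G over C(0), write G* = G(x*), s* = Σ_i x*_i, χ* = x*/s*, and suppose x*_i > 1 for every i. Let s₁ and s₂ be the minimum and maximum of Σ_i x_i over C(0), n₁ = ⌈s₁⌉, n₂ = ⌈s₂⌉. Let ν* ∈ ℕ^m satisfy Σ_i ν*_i = ⌈s*⌉ and ‖ν* − x*‖_∞ ≤ 1. For δ, η > 0 let B = { ν ∈ ℕ^m : n₁ ≤ Σ_i ν_i ≤ n₂, b^E − δ|b^E| ≤ A^E ν ≤ b^E + δ|b^E|, A^I ν ≤ b^I + δ|b^I|, G(ν) < (1−η)·G* }. Then #ν* > ( (m+1)·e^{−m/12}·Γ(m/2) / (2·π^{m/2}) ) · ( C₂·C₄ / C₃ ) · e^{η·G*} · #B, where #ν denotes the multinomial coefficient ((Σ_i ν_i)! / ∏_i ν_i!), #B = Σ_{ν∈B} #ν, C₂ = √(s*)·∏_{i=1}^m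 ( χ*_i / √(x*_i + 1) ), C₄ = exp( −(1/2)·( Σ_{i=1}^m 1/(x*_i − 1) − m/(s*/m − 1) ) ), and C₃ = (√m + √(s₂+2))^{m+1} − (√m + √s₁)^{m+1}. -/

import Mathlib

open scoped BigOperators

/-- Generalized entropy `G(x) = -∑ xᵢ ln xᵢ + (∑ xᵢ) ln (∑ xᵢ)`
(with the convention `0 ln 0 = 0`, automatic since `Real.log 0 = 0`). -/
noncomputable def genEntropy {m : ℕ} (x : Fin m → ℝ) : ℝ :=
  -(∑ i, x i * Real.log (x i)) + (∑ i, x i) * Real.log (∑ i, x i)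

/-- The quotient `k! / (k / e) ^ k`, which Stirling's formula compares with `√(2πk)`. -/
noncomputable def factorialQuot (k : ℕ) : ℝ :=
  (k.factorial : ℝ) * Real.exp k / (k : ℝ) ^ k

/-- `1` at `0` and `1 / √(2πk)` at `k > 0`: an upper bound for `1 / factorialQuot k`. -/
noncomputable def stirlingWeight (k : ℕ) : ℝ :=
  if k = 0 then 1 else 1 / √(2 * Real.pi * k)

lemma pow_self_pos (k : ℕ) : (0 : ℝ) < (k : ℝ) ^ k := by
  rcases Nat.eq_zero_or_pos k with rfl | h
  · simp
  · positivity

lemma factorialQuot_pos (k : ℕ) : 0 < factorialQuot k := by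
  have := pow_self_pos k
  unfold factorialQuot
  positivity

lemma factorialQuot_eq (k : ℕ) (hk : k ≠ 0) :
    factorialQuot k = Stirling.stirlingSeq k * √(2 * k) := by
  have hk' : (0 : ℝ) < k := by positivity
  have : √(2 * (k : ℝ)) ≠ 0 := by positivity
  unfold factorialQuot Stirling.stirlingSeq
  rw [div_pow, ← Real.exp_nat_mul, mul_one]
  field_simp

lemma stirlingSeq_le {k n : ℕ} (hk : k ≠ 0) (hkn : k ≤ n) :
    Stirling.stirlingSeq n ≤ Stirling.stirlingSeq k := by
  obtain ⟨k, rfl⟩ := Nat.exists_eq_succ_of_ne_zero hk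
  obtain ⟨n, rfl⟩ := Nat.exists_eq_succ_of_ne_zero (show n ≠ 0 by omega)
  exact Stirling.stirlingSeq'_antitone (by omega : k ≤ n)

lemma sqrt_two_pi_mul (k : ℝ) : √(2 * Real.pi * k) = √Real.pi * √(2 * k) := by
  rw [← Real.sqrt_mul Real.pi_pos.le]
  ring_nf

lemma sqrt_le_factorialQuot (k : ℕ) : √(2 * Real.pi * k) ≤ factorialQuot k := by
  rcases eq_or_ne k 0 with rfl | hk
  · simpa using (factorialQuot_pos 0).le
  rw [factorialQuot_eq k hk, sqrt_two_pi_mul]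
  gcongr
  exact Stirling.sqrt_pi_le_stirlingSeq hk

lemma stirlingWeight_pos (k : ℕ) : 0 < stirlingWeight k := by
  unfold stirlingWeight
  split_ifs with h
  · exact one_pos
  · have := Nat.pos_of_ne_zero h
    positivity

lemma one_le_factorialQuot_mul_stirlingWeight (k : ℕ) :
    1 ≤ factorialQuot k * stirlingWeight k := by
  unfold stirlingWeight
  split_ifs with h
  · simp [h, factorialQuot]
  · have := Nat.pos_of_ne_zero h
    rw [mul_one_div, one_le_div (by positivity)]
    exact sqrt_le_factorialQuot k

lemma factorialQuot_le_sqrt_mul {k n : ℕ} (hk : k ≠ 0) (hkn : k ≤ n) :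
    factorialQuot n ≤ √(2 * Real.pi * n) * (factorialQuot k * stirlingWeight k) := by
  have hk' : (0 : ℝ) < k := by positivity
  rw [factorialQuot_eq k hk, factorialQuot_eq n (by omega), stirlingWeight, if_neg hk,
    sqrt_two_pi_mul, sqrt_two_pi_mul]
  have h : √Real.pi ≠ 0 := by positivity
  have h2 : √(2 * (k : ℝ)) ≠ 0 := by positivity
  calc _ ≤ Stirling.stirlingSeq k * √(2 * n) := by
        gcongr
        exact stirlingSeq_le hk hkn
    _ = _ := by field_simp

lemma factorialQuot_lt {k : ℕ} (hk : k ≠ 0) :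
    factorialQuot k < Real.exp (1 / 12) * √(2 * Real.pi * k) := by
  have hk' : (0 : ℝ) < k := by positivity
  have key : Real.exp 1 < Real.exp (1 / 12) * √(2 * Real.pi) := by
    have h1 : Real.exp 1 = Real.exp (1 / 12) * Real.exp (11 / 12) := by
      rw [← Real.exp_add]; norm_num
    rw [h1]
    gcongr
    apply Real.lt_sqrt_of_sq_lt
    refine lt_of_pow_lt_pow_left₀ 6 (by positivity) ?_
    have h2 : (Real.exp (11 / 12) ^ 2) ^ 6 = Real.exp 1 ^ 11 := by
      rw [← pow_mul, ← Real.exp_nat_mul, ← Real.exp_nat_mul]; norm_num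
    rw [h2]
    calc Real.exp 1 ^ 11 < 2.7182818286 ^ 11 := by
          gcongr
          exact Real.exp_one_lt_d9
      _ < (2 * 3.1415) ^ 6 := by norm_num
      _ < (2 * Real.pi) ^ 6 := by
          gcongr
          exact Real.pi_gt_d4
  rw [factorialQuot_eq k hk, Real.sqrt_mul (by positivity : 0 ≤ 2 * Real.pi),
    Real.sqrt_mul zero_le_two]
  calc _ ≤ Stirling.stirlingSeq 1 * (√2 * √k) := by
        gcongr
        exact stirlingSeq_le one_ne_zero (by omega)
    _ = Real.exp 1 * √k := by
        rw [Stirling.stirlingSeq_one]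
        field_simp
    _ < _ := by
        rw [← mul_assoc]
        gcongr

lemma exp_mul_log_self (k : ℕ) : Real.exp (k * Real.log k) = (k : ℝ) ^ k := by
  rcases Nat.eq_zero_or_pos k with rfl | h
  · simp
  · rw [Real.exp_nat_mul, Real.exp_log (by positivity)]

lemma exp_genEntropy_natCast {m : ℕ} (ν : Fin m → ℕ) :
    Real.exp (genEntropy fun i => (ν i : ℝ)) =
      ((∑ i, ν i : ℕ) : ℝ) ^ (∑ i, ν i) / ∏ i, (ν i : ℝ) ^ ν i := by
  rw [genEntropy, ← Nat.cast_sum, add_comm, ← sub_eq_add_neg, Real.exp_sub, exp_mul_log_self,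
    Real.exp_sum]
  simp_rw [exp_mul_log_self]

lemma multinomial_eq_mul_exp_genEntropy {m : ℕ} (ν : Fin m → ℕ) :
    (Nat.multinomial Finset.univ ν : ℝ) =
      factorialQuot (∑ i, ν i) / (∏ i, factorialQuot (ν i)) *
        Real.exp (genEntropy fun i => (ν i : ℝ)) := by
  have h := Nat.multinomial_spec Finset.univ ν
  have h' : (∏ i, ((ν i).factorial : ℝ)) * (Nat.multinomial Finset.univ ν : ℝ) =
      ((∑ i, ν i).factorial : ℝ) := by exact_mod_cast h
  have h1 : (∏ i, ((ν i).factorial : ℝ)) ≠ 0 := by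
    rw [Finset.prod_ne_zero_iff]; intros; positivity
  have h2 : (∏ i, (ν i : ℝ) ^ ν i) ≠ 0 := by
    rw [Finset.prod_ne_zero_iff]; intros i _; exact (pow_self_pos _).ne'
  have h3 := (pow_self_pos (∑ i, ν i)).ne'
  rw [exp_genEntropy_natCast]
  unfold factorialQuot
  rw [Finset.prod_div_distrib, Finset.prod_mul_distrib, ← Real.exp_sum, ← Nat.cast_sum, ← h']
  field_simp

lemma multinomial_mul_exp_neg_genEntropy_le {m : ℕ} (ν : Fin m → ℕ) {n : ℕ} (hn : n ≠ 0)
    (hν : ∑ i, ν i = n) :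
    (Nat.multinomial Finset.univ ν : ℝ) * Real.exp (-genEntropy fun i => (ν i : ℝ)) ≤
      √(2 * Real.pi * n) * ∏ i, stirlingWeight (ν i) := by
  rw [multinomial_eq_mul_exp_genEntropy, hν, mul_assoc, ← Real.exp_add, add_neg_cancel,
    Real.exp_zero, mul_one, div_le_iff₀ (Finset.prod_pos fun i _ => factorialQuot_pos _),
    mul_assoc, ← Finset.prod_mul_distrib]
  obtain ⟨j, -, hj⟩ : ∃ j ∈ Finset.univ, ν j ≠ 0 := by
    by_contra! h
    exact hn (hν ▸ Finset.sum_eq_zero h)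
  have hjn : ν j ≤ n := hν ▸ Finset.single_le_sum (fun i _ => Nat.zero_le (ν i)) (Finset.mem_univ j)
  calc _ ≤ √(2 * Real.pi * n) * (stirlingWeight (ν j) * factorialQuot (ν j)) := by
        rw [mul_comm (stirlingWeight _)]
        exact factorialQuot_le_sqrt_mul hj hjn
    _ ≤ _ := by
        gcongr
        rw [← Finset.mul_prod_erase _ _ (Finset.mem_univ j)]
        refine le_mul_of_one_le_right
          (mul_pos (stirlingWeight_pos _) (factorialQuot_pos _)).le ?_
        refine Finset.prod_induction _ (fun x : ℝ => 1 ≤ x)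
          (fun _ _ => one_le_mul_of_one_le_of_one_le) le_rfl fun i _ => ?_
        rw [mul_comm]
        exact one_le_factorialQuot_mul_stirlingWeight _

lemma one_div_sqrt_le_arcsin_sub_arcsin {n k : ℕ} (hk : 0 < k) (hkn : k < n) :
    1 / √((k : ℝ) * (n - k)) ≤
      Real.arcsin ((2 * k + 1) / n - 1) - Real.arcsin ((2 * k - 1) / n - 1) := by
  have hk1 : (1 : ℝ) ≤ k := by exact_mod_cast hk
  have hkn1 : (k : ℝ) + 1 ≤ n := by exact_mod_cast hkn
  have hn : (0 : ℝ) < n := by linarith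
  set a := Real.arcsin ((2 * k + 1) / n - 1) with ha
  set b := Real.arcsin ((2 * k - 1) / n - 1) with hb
  have hsa : Real.sin a = (2 * k + 1) / n - 1 := by
    apply Real.sin_arcsin
    · have : (0 : ℝ) ≤ (2 * k + 1) / n := by positivity
      linarith
    · have : ((2 : ℝ) * k + 1) / n ≤ 2 := by rw [div_le_iff₀ hn]; linarith
      linarith
  have hsb : Real.sin b = (2 * k - 1) / n - 1 := by
    apply Real.sin_arcsin
    · have : (0 : ℝ) ≤ (2 * k - 1) / n := div_nonneg (by linarith) hn.le
      linarith
    · have : ((2 : ℝ) * k - 1) / n ≤ 2 := by rw [div_le_iff₀ hn]; linarith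
      linarith
  have hba : b ≤ a := Real.monotone_arcsin (by gcongr; linarith)
  set u := (a + b) / 2 with hu
  set v := (a - b) / 2 with hv
  have hau : a = u + v := by rw [hu, hv]; ring
  have hbu : b = u - v := by rw [hu, hv]; ring
  rw [hau, Real.sin_add] at hsa
  rw [hbu, Real.sin_sub] at hsb
  have hv0 : 0 ≤ v := by rw [hv]; linarith
  have h1 : Real.sin u * Real.cos v = 2 * k / n - 1 := by
    field_simp at hsa hsb ⊢; linarith
  have h2 : Real.cos u * Real.sin v = 1 / n := by
    field_simp at hsa hsb ⊢; linarith
  have hcu : 0 ≤ Real.cos u := by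
    apply Real.cos_nonneg_of_neg_pi_div_two_le_of_le
    · have := Real.neg_pi_div_two_le_arcsin ((2 * k + 1) / n - 1)
      have := Real.neg_pi_div_two_le_arcsin ((2 * k - 1) / n - 1)
      rw [hu]; linarith
    · have := Real.arcsin_le_pi_div_two ((2 * k + 1) / n - 1)
      have := Real.arcsin_le_pi_div_two ((2 * k - 1) / n - 1)
      rw [hu]; linarith
  have hpos : (0 : ℝ) < k * (n - k) := mul_pos (by linarith) (by linarith)
  have h3 : Real.cos u ≤ 2 / n * √((k : ℝ) * (n - k)) := by
    refine le_of_sq_le_sq ?_ (by positivity)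
    rw [mul_pow, Real.sq_sqrt hpos.le]
    have e : (2 / (n : ℝ)) ^ 2 * (k * (n - k)) = 1 - (2 * k / n - 1) ^ 2 := by
      field_simp; ring
    rw [e, ← h1]
    nlinarith [Real.sin_sq_add_cos_sq u, Real.cos_sq_le_one v, sq_nonneg (Real.sin u)]
  have h4 : 1 / (n : ℝ) ≤ 2 / n * √((k : ℝ) * (n - k)) * v := by
    rw [← h2]
    calc _ ≤ Real.cos u * v := by gcongr; exact Real.sin_le hv0
      _ ≤ _ := by gcongr
  have : a - b = 2 * v := by rw [hv]; ring
  rw [this, div_le_iff₀ (by positivity)]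
  field_simp at h4
  linarith

lemma sum_one_div_sqrt_mul_le_pi (n : ℕ) :
    ∑ k ∈ Finset.Ico 1 n, 1 / √((k : ℝ) * (n - k)) ≤ Real.pi := by
  rcases Nat.eq_zero_or_pos n with rfl | hn
  · simpa using Real.pi_pos.le
  calc _ ≤ ∑ k ∈ Finset.Ico 1 n, (Real.arcsin ((2 * ((k + 1 : ℕ) : ℝ) - 1) / n - 1) -
          Real.arcsin ((2 * (k : ℝ) - 1) / n - 1)) := by
        refine Finset.sum_le_sum fun k hk => ?_
        rw [Finset.mem_Ico] at hk
        have := one_div_sqrt_le_arcsin_sub_arcsin hk.1 hk.2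
        have e : 2 * ((k + 1 : ℕ) : ℝ) - 1 = 2 * k + 1 := by push_cast; ring
        rwa [e]
    _ = Real.arcsin ((2 * (n : ℝ) - 1) / n - 1) - Real.arcsin ((2 * ((1 : ℕ) : ℝ) - 1) / n - 1) :=
        Finset.sum_Ico_sub (fun k : ℕ => Real.arcsin ((2 * (k : ℝ) - 1) / n - 1)) hn
    _ ≤ _ := by
        have := Real.arcsin_le_pi_div_two ((2 * (n : ℝ) - 1) / n - 1)
        have := Real.neg_pi_div_two_le_arcsin ((2 * ((1 : ℕ) : ℝ) - 1) / n - 1)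
        linarith

lemma half_mul_pow_le_pow_sub_pow {b c : ℝ} (hb : 0 ≤ b) (hc : 0 ≤ c) (h : c ^ 2 = b ^ 2 + 1) (r : ℕ) :
    ((r : ℝ) + 2) / 2 * b ^ r ≤ c ^ (r + 2) - b ^ (r + 2) := by
  induction r using Nat.twoStepInduction with
  | zero => simp [h]
  | one =>
    have : b ^ 3 + 3 / 2 * b ≤ c ^ 3 := by
      refine le_of_sq_le_sq ?_ (by positivity)
      have e : (c ^ 3) ^ 2 = (b ^ 2 + 1) ^ 3 := by rw [← h]; ring
      rw [e]
      nlinarith [sq_nonneg b]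
    norm_num
    linarith
  | more r ih _ =>
    have e : c ^ (r + 2 + 2) = c ^ (r + 2) * (b ^ 2 + 1) := by rw [← h]; ring
    rw [e]
    have : (b ^ (r + 2) + ((r : ℝ) + 2) / 2 * b ^ r) * (b ^ 2 + 1) ≤ c ^ (r + 2) * (b ^ 2 + 1) := by
      gcongr
      linarith
    have h0 : 0 ≤ ((r : ℝ) + 2) / 2 * b ^ r := by positivity
    push_cast
    ring_nf at this h0 ⊢
    linarith

lemma sum_sqrt_pow_div_le (r n : ℕ) (hr : 1 ≤ r) :
    ∑ j ∈ Finset.Ico 1 n, √(j : ℝ) ^ r / j ≤ 2 / r * √(n : ℝ) ^ r := by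
  rcases hr.eq_or_lt with rfl | hr2
  · rcases Nat.eq_zero_or_pos n with rfl | hn
    · simp
    have key : ∀ n : ℕ, ∑ j ∈ Finset.Ico 1 (n + 1), √(j : ℝ) ^ 1 / j ≤ 2 * √(n : ℝ) := by
      intro n
      induction n with
      | zero => simp
      | succ n ih =>
        rw [Finset.sum_Ico_succ_top (by omega)]
        have hs := Real.sq_sqrt (Nat.cast_nonneg (α := ℝ) n)
        have hs' := Real.sq_sqrt (Nat.cast_nonneg (α := ℝ) (n + 1))
        have hp : 0 < √((n + 1 : ℕ) : ℝ) := by positivity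
        have : √((n + 1 : ℕ) : ℝ) ^ 1 / ((n + 1 : ℕ) : ℝ) = 1 / √((n + 1 : ℕ) : ℝ) := by
          nth_rewrite 2 [← hs']
          field_simp
        rw [this]
        have h2 : 1 / √((n + 1 : ℕ) : ℝ) ≤ 2 * √((n + 1 : ℕ) : ℝ) - 2 * √(n : ℝ) := by
          rw [div_le_iff₀ hp]
          push_cast at hs' ⊢
          nlinarith [sq_nonneg (√((n : ℝ) + 1) - √(n : ℝ))]
        linarith
    obtain ⟨n, rfl⟩ := Nat.exists_eq_succ_of_ne_zero hn.ne'
    refine (key n).trans ?_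
    norm_num
    gcongr
    simp
  · obtain ⟨r, rfl⟩ := Nat.exists_eq_add_of_le' hr2
    induction n with
    | zero => simp
    | succ n ih =>
      rcases Nat.eq_zero_or_pos n with rfl | hn
      · simp; positivity
      rw [Finset.sum_Ico_succ_top (by omega)]
      have hn' : (0 : ℝ) < n := by exact_mod_cast hn
      have h := half_mul_pow_le_pow_sub_pow (Real.sqrt_nonneg n) (Real.sqrt_nonneg (n + 1 : ℕ))
        (by rw [Real.sq_sqrt (by positivity), Real.sq_sqrt (by positivity)]; push_cast; ring) r
      have e : √(n : ℝ) ^ (r + 2) / n = √(n : ℝ) ^ r := by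
        rw [pow_add, Real.sq_sqrt hn'.le]; field_simp
      rw [e]
      have hr' : (0 : ℝ) < (r : ℝ) + 2 := by positivity
      have h' : √(n : ℝ) ^ r ≤ 2 / ((r + 2 : ℕ) : ℝ) *
          (√((n + 1 : ℕ) : ℝ) ^ (r + 2) - √(n : ℝ) ^ (r + 2)) := by
        push_cast at h ⊢
        rw [div_mul_eq_mul_div, le_div_iff₀ hr']
        linarith
      rw [mul_sub] at h'
      linarith

lemma Gamma_add_half_le {x : ℝ} (hx : 0 < x) :
    Real.Gamma (x + 1 / 2) ≤ √x * Real.Gamma x := by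
  have h := Real.Gamma_mul_add_mul_le_rpow_Gamma_mul_rpow_Gamma hx (by linarith : 0 < x + 1)
    (by norm_num : (0 : ℝ) < 1 / 2) (by norm_num : (0 : ℝ) < 1 / 2) (by norm_num)
  have hG := Real.Gamma_pos_of_pos hx
  rw [Real.Gamma_add_one hx.ne', ← Real.sqrt_eq_rpow, ← Real.sqrt_eq_rpow,
    Real.sqrt_mul hx.le] at h
  calc Real.Gamma (x + 1 / 2) = Real.Gamma (1 / 2 * x + 1 / 2 * (x + 1)) := by ring_nf
    _ ≤ _ := h
    _ = √x * (√(Real.Gamma x) * √(Real.Gamma x)) := by ring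
    _ = _ := by rw [Real.mul_self_sqrt hG.le]

lemma Gamma_half_le {r k m : ℕ} (hr : 1 ≤ r) (h : r + k ≤ m) :
    Real.Gamma (((r + k : ℕ) : ℝ) / 2) ≤ √((m : ℝ) / 2) ^ k * Real.Gamma ((r : ℝ) / 2) := by
  induction k with
  | zero => simp
  | succ k ih =>
    have hp : (0 : ℝ) < ((r + k : ℕ) : ℝ) / 2 := by
      have : 0 < r + k := by omega
      positivity
    have hG := Real.Gamma_pos_of_pos hp
    have hle : ((r + k : ℕ) : ℝ) ≤ m := by exact_mod_cast (by omega : r + k ≤ m)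
    have e : ((r + (k + 1) : ℕ) : ℝ) / 2 = ((r + k : ℕ) : ℝ) / 2 + 1 / 2 := by push_cast; ring
    calc _ ≤ √(((r + k : ℕ) : ℝ) / 2) * Real.Gamma (((r + k : ℕ) : ℝ) / 2) := by
          rw [e]; exact Gamma_add_half_le hp
      _ ≤ √((m : ℝ) / 2) * (√((m : ℝ) / 2) ^ k * Real.Gamma ((r : ℝ) / 2)) := by
          gcongr
          exact ih (by omega)
      _ = _ := by ring

/-- The generating series of `1 / √(2πk)` over the positive integers `k`. -/
noncomputable def weightSeries : PowerSeries ℝ :=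
  PowerSeries.mk fun k => if k = 0 then 0 else 1 / √(2 * Real.pi * k)

lemma coeff_weightSeries (k : ℕ) : PowerSeries.coeff k weightSeries = 1 / √(2 * Real.pi * k) := by
  rcases eq_or_ne k 0 with rfl | h <;> simp [weightSeries, *]

lemma coeff_weightSeries_nonneg (k : ℕ) : 0 ≤ PowerSeries.coeff k weightSeries := by
  rw [coeff_weightSeries]; positivity

lemma constantCoeff_weightSeries : PowerSeries.constantCoeff weightSeries = 0 := by
  simp [weightSeries, ← PowerSeries.coeff_zero_eq_constantCoeff_apply]

lemma one_add_weightSeries : 1 + weightSeries = PowerSeries.mk stirlingWeight := by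
  ext k
  rcases eq_or_ne k 0 with rfl | h <;>
    simp [weightSeries, stirlingWeight, PowerSeries.coeff_one, *]

lemma coeff_mul_eq_sum_Ico {f g : PowerSeries ℝ} (hf : PowerSeries.constantCoeff f = 0)
    (hg : PowerSeries.constantCoeff g = 0) (n : ℕ) :
    PowerSeries.coeff n (f * g) =
      ∑ k ∈ Finset.Ico 1 n, PowerSeries.coeff k f * PowerSeries.coeff (n - k) g := by
  rw [PowerSeries.coeff_mul, Finset.Nat.sum_antidiagonal_eq_sum_range_succ_mk]
  symm
  apply Finset.sum_subset
  · intro k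
    simp only [Finset.mem_Ico, Finset.mem_range]
    omega
  · intro k h1 h2
    simp only [Finset.mem_Ico, Finset.mem_range] at h1 h2
    rcases Nat.eq_zero_or_pos k with rfl | hk
    · simp [hf]
    · have : n - k = 0 := by omega
      simp [this, hg]

lemma constantCoeff_weightSeries_pow {r : ℕ} (hr : r ≠ 0) :
    PowerSeries.constantCoeff (weightSeries ^ r) = 0 := by
  rw [map_pow, constantCoeff_weightSeries, zero_pow hr]

lemma coeff_weightSeries_sq_le (n : ℕ) : PowerSeries.coeff n (weightSeries ^ 2) ≤ 1 / 2 := by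
  rw [sq, coeff_mul_eq_sum_Ico constantCoeff_weightSeries constantCoeff_weightSeries]
  calc _ = 1 / (2 * Real.pi) * ∑ k ∈ Finset.Ico 1 n, 1 / √((k : ℝ) * (n - k)) := by
        rw [Finset.mul_sum]
        refine Finset.sum_congr rfl fun k hk => ?_
        rw [Finset.mem_Ico] at hk
        have hpi : 0 ≤ 2 * Real.pi := by positivity
        rw [coeff_weightSeries, coeff_weightSeries, Nat.cast_sub hk.2.le, Real.sqrt_mul hpi,
          Real.sqrt_mul hpi, Real.sqrt_mul (Nat.cast_nonneg k)]
        nth_rewrite 3 [← Real.mul_self_sqrt hpi]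
        field_simp
    _ ≤ 1 / (2 * Real.pi) * Real.pi := by
        gcongr
        exact sum_one_div_sqrt_mul_le_pi n
    _ = _ := by field_simp

lemma coeff_weightSeries_pow_le (r : ℕ) (hr : 1 ≤ r) (n : ℕ) :
    PowerSeries.coeff n (weightSeries ^ r) ≤
      1 / (√2 ^ r * Real.Gamma ((r : ℝ) / 2)) * (√(n : ℝ) ^ r / n) := by
  induction r using Nat.twoStepInduction generalizing n with
  | zero => omega
  | one =>
    rcases eq_or_ne n 0 with rfl | hn
    · simp [constantCoeff_weightSeries]
    have hn' : (0 : ℝ) < n := by positivity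
    rw [pow_one, coeff_weightSeries]
    simp only [Nat.cast_one, Real.Gamma_one_half_eq, pow_one]
    rw [Real.sqrt_mul (by positivity), Real.sqrt_mul zero_le_two]
    apply le_of_eq
    nth_rewrite 3 [← Real.mul_self_sqrt hn'.le]
    field_simp
  | more r ih _ =>
    rcases Nat.eq_zero_or_pos r with rfl | hr0
    · rcases eq_or_ne n 0 with rfl | hn
      · simp [constantCoeff_weightSeries]
      have hn' : (0 : ℝ) < n := by positivity
      refine (coeff_weightSeries_sq_le n).trans (le_of_eq ?_)
      norm_num
      exact hn
    have hr' : (0 : ℝ) < r := by exact_mod_cast hr0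
    have hG := Real.Gamma_pos_of_pos (half_pos hr')
    rw [pow_add, mul_comm, coeff_mul_eq_sum_Ico (constantCoeff_weightSeries_pow two_ne_zero)
      (constantCoeff_weightSeries_pow hr0.ne')]
    calc _ ≤ ∑ k ∈ Finset.Ico 1 n, 1 / 2 * (1 / (√2 ^ r * Real.Gamma ((r : ℝ) / 2)) *
            (√((n - k : ℕ) : ℝ) ^ r / (n - k : ℕ))) := by
          refine Finset.sum_le_sum fun k _ => ?_
          calc _ ≤ PowerSeries.coeff k (weightSeries ^ 2) *
                (1 / (√2 ^ r * Real.Gamma ((r : ℝ) / 2)) *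
                  (√((n - k : ℕ) : ℝ) ^ r / (n - k : ℕ))) := by
                gcongr
                · rw [sq, PowerSeries.coeff_mul]
                  exact Finset.sum_nonneg fun _ _ =>
                    mul_nonneg (coeff_weightSeries_nonneg _) (coeff_weightSeries_nonneg _)
                · exact ih hr0 _
            _ ≤ _ := by
                gcongr
                exact coeff_weightSeries_sq_le k
      _ = 1 / 2 * (1 / (√2 ^ r * Real.Gamma ((r : ℝ) / 2))) *
            ∑ j ∈ Finset.Ico 1 n, √(j : ℝ) ^ r / j := by
          have h := Finset.sum_Ico_reflect (fun j : ℕ => √(j : ℝ) ^ r / j) 1 (Nat.le_succ n)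
          rw [Nat.add_sub_cancel_left, Nat.add_sub_cancel] at h
          rw [← h, Finset.mul_sum]
          exact Finset.sum_congr rfl fun _ _ => by ring
      _ ≤ 1 / 2 * (1 / (√2 ^ r * Real.Gamma ((r : ℝ) / 2))) * (2 / r * √(n : ℝ) ^ r) := by
          gcongr
          exact sum_sqrt_pow_div_le r n hr0
      _ ≤ _ := by
          rcases eq_or_ne n 0 with rfl | hn
          · simp [hr0.ne']
          have hn' : (0 : ℝ) < n := by positivity
          have e : ((r + 2 : ℕ) : ℝ) / 2 = (r : ℝ) / 2 + 1 := by push_cast; ring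
          rw [e, Real.Gamma_add_one (by positivity), pow_add, pow_add, Real.sq_sqrt zero_le_two,
            Real.sq_sqrt hn'.le]
          apply le_of_eq
          field_simp

/-- The sum `∑ r ∈ [1, m], C(m, r) (√m)^(m - r) (√n)^(r - 1)`, i.e. the quotient
`((√m + √n)^m - (√m)^m) / √n` extended to `n = 0`. -/
noncomputable def binomQuot (m n : ℕ) : ℝ :=
  ∑ r ∈ Finset.range m, (m.choose (r + 1) : ℝ) * √(m : ℝ) ^ (m - (r + 1)) * √(n : ℝ) ^ r

lemma one_div_Gamma_half_le {r m : ℕ} (hr : 1 ≤ r) (hrm : r ≤ m) :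
    1 / (√2 ^ r * Real.Gamma ((r : ℝ) / 2)) ≤
      1 / (√2 ^ m * Real.Gamma ((m : ℝ) / 2)) * √(m : ℝ) ^ (m - r) := by
  obtain ⟨k, rfl⟩ := Nat.exists_eq_add_of_le hrm
  have hr' : (0 : ℝ) < r := by exact_mod_cast hr
  have hm' : (0 : ℝ) < (r + k : ℕ) := by exact_mod_cast (by omega : 0 < r + k)
  have hG := Real.Gamma_pos_of_pos (half_pos hr')
  have hG' := Real.Gamma_pos_of_pos (half_pos hm')
  have h := Gamma_half_le hr (le_refl (r + k))
  rw [Real.sqrt_div (by positivity), div_pow] at h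
  rw [Nat.add_sub_cancel_left, div_mul_eq_mul_div, div_le_div_iff₀ (by positivity) (by positivity),
    one_mul, one_mul, pow_add]
  rw [div_mul_eq_mul_div, le_div_iff₀ (by positivity)] at h
  calc _ = √2 ^ r * (Real.Gamma (((r + k : ℕ) : ℝ) / 2) * √2 ^ k) := by ring
    _ ≤ √2 ^ r * (√((r + k : ℕ) : ℝ) ^ k * Real.Gamma ((r : ℝ) / 2)) := by gcongr
    _ = _ := by ring

lemma sum_piAntidiag_prod_stirlingWeight (m n : ℕ) :
    ∑ ν ∈ Finset.piAntidiag (Finset.univ : Finset (Fin m)) n, ∏ i, stirlingWeight (ν i) =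
      PowerSeries.coeff n ((1 + weightSeries) ^ m) := by
  have h : (1 + weightSeries) ^ m = ∏ _i : Fin m, PowerSeries.mk stirlingWeight := by
    rw [one_add_weightSeries]; simp
  rw [h, PowerSeries.coeff_prod]
  refine Finset.sum_bij' (fun ν _ => Finsupp.equivFunOnFinite.symm ν) (fun l _ => ⇑l) ?_ ?_ ?_ ?_ ?_
  · intro ν hν
    rw [Finset.mem_piAntidiag] at hν
    rw [Finset.mem_finsuppAntidiag]
    exact ⟨by simpa using hν.1, Finset.subset_univ _⟩
  · intro l hl
    rw [Finset.mem_finsuppAntidiag] at hl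
    rw [Finset.mem_piAntidiag]
    exact ⟨hl.1, fun _ _ => Finset.mem_univ _⟩
  · intros; rfl
  · intros; ext; rfl
  · intros; simp

lemma sqrt_mul_coeff_one_add_weightSeries_pow_le {m n : ℕ} (hn : n ≠ 0) :
    √(n : ℝ) * PowerSeries.coeff n ((1 + weightSeries) ^ m) ≤
      1 / (√2 ^ m * Real.Gamma ((m : ℝ) / 2)) * binomQuot m n := by
  have hn' : (0 : ℝ) < n := by positivity
  rw [add_comm, add_pow, Finset.sum_range_succ', map_add, map_sum]
  have h0 : PowerSeries.coeff n (weightSeries ^ 0 * 1 ^ (m - 0) * ((m.choose 0 : ℕ) : PowerSeries ℝ))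
      = 0 := by
    simp [PowerSeries.coeff_one, hn]
  rw [h0, add_zero, binomQuot, Finset.mul_sum, Finset.mul_sum]
  refine Finset.sum_le_sum fun r hr => ?_
  rw [Finset.mem_range] at hr
  have e : weightSeries ^ (r + 1) * 1 ^ (m - (r + 1)) * ((m.choose (r + 1) : ℕ) : PowerSeries ℝ) =
      (m.choose (r + 1)) • weightSeries ^ (r + 1) := by
    rw [one_pow, mul_one, nsmul_eq_mul, mul_comm]
  rw [e, map_nsmul, nsmul_eq_mul]
  have e2 : √(n : ℝ) * (√(n : ℝ) ^ (r + 1) / n) = √(n : ℝ) ^ r := by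
    nth_rewrite 3 [← Real.mul_self_sqrt hn'.le]
    rw [pow_succ]
    field_simp
  calc _ ≤ √(n : ℝ) * ((m.choose (r + 1) : ℝ) * (1 / (√2 ^ m * Real.Gamma ((m : ℝ) / 2)) *
          √(m : ℝ) ^ (m - (r + 1)) * (√(n : ℝ) ^ (r + 1) / n))) := by
        gcongr
        refine (coeff_weightSeries_pow_le (r + 1) (by omega) n).trans ?_
        gcongr
        exact one_div_Gamma_half_le (by omega) hr
    _ = (m.choose (r + 1) : ℝ) * (1 / (√2 ^ m * Real.Gamma ((m : ℝ) / 2)) *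
          √(m : ℝ) ^ (m - (r + 1))) * (√(n : ℝ) * (√(n : ℝ) ^ (r + 1) / n)) := by ring
    _ = _ := by rw [e2]; ring

lemma one_le_mul_binomQuot_zero {m : ℕ} (hm : 1 ≤ m) :
    1 ≤ √(2 * Real.pi) * (1 / (√2 ^ m * Real.Gamma ((m : ℝ) / 2)) * binomQuot m 0) := by
  have h := one_div_Gamma_half_le le_rfl hm
  have hm' : (1 : ℝ) ≤ m := by exact_mod_cast hm
  have e : binomQuot m 0 = m * √(m : ℝ) ^ (m - 1) := by
    rw [binomQuot, Finset.sum_eq_single 0]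
    · simp
    · intro r _ hr; simp [hr]
    · intro h; simp at h; omega
  rw [e]
  have e2 : √(2 * Real.pi) * (1 / (√2 ^ 1 * Real.Gamma (((1 : ℕ) : ℝ) / 2))) = 1 := by
    rw [Nat.cast_one, Real.Gamma_one_half_eq, Real.sqrt_mul zero_le_two]
    field_simp
  calc 1 ≤ (m : ℝ) * (√(2 * Real.pi) * (1 / (√2 ^ 1 * Real.Gamma (((1 : ℕ) : ℝ) / 2)))) := by
        rw [e2]; linarith
    _ ≤ (m : ℝ) * (√(2 * Real.pi) * (1 / (√2 ^ m * Real.Gamma ((m : ℝ) / 2)) *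
          √(m : ℝ) ^ (m - 1))) := by gcongr
    _ = _ := by ring

lemma sum_multinomial_mul_exp_le {m : ℕ} (hm : 1 ≤ m) (n : ℕ) :
    ∑ ν ∈ Finset.piAntidiag (Finset.univ : Finset (Fin m)) n,
        (Nat.multinomial Finset.univ ν : ℝ) * Real.exp (-genEntropy fun i => (ν i : ℝ)) ≤
      √(2 * Real.pi) * (1 / (√2 ^ m * Real.Gamma ((m : ℝ) / 2)) * binomQuot m n) := by
  rcases eq_or_ne n 0 with rfl | hn
  · simpa [Nat.multinomial, genEntropy] using one_le_mul_binomQuot_zero hm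
  calc _ ≤ ∑ ν ∈ Finset.piAntidiag (Finset.univ : Finset (Fin m)) n,
          √(2 * Real.pi * n) * ∏ i, stirlingWeight (ν i) := by
        refine Finset.sum_le_sum fun ν hν => ?_
        rw [Finset.mem_piAntidiag] at hν
        exact multinomial_mul_exp_neg_genEntropy_le ν hn hν.1
    _ = √(2 * Real.pi) * (√(n : ℝ) * PowerSeries.coeff n ((1 + weightSeries) ^ m)) := by
        rw [← Finset.mul_sum, sum_piAntidiag_prod_stirlingWeight, Real.sqrt_mul (by positivity),
          mul_assoc]
    _ ≤ _ := mul_le_mul_of_nonneg_left (sqrt_mul_coeff_one_add_weightSeries_pow_le hn)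
        (Real.sqrt_nonneg _)

lemma binomQuot_le (m n : ℕ) :
    binomQuot m n ≤ 2 / (m + 1) *
      ((√(m : ℝ) + √((n + 1 : ℕ) : ℝ)) ^ (m + 1) - (√(m : ℝ) + √(n : ℝ)) ^ (m + 1)) := by
  have hm : (0 : ℝ) < m + 1 := by positivity
  have hsq : √((n + 1 : ℕ) : ℝ) ^ 2 = √(n : ℝ) ^ 2 + 1 := by
    rw [Real.sq_sqrt (by positivity), Real.sq_sqrt (by positivity)]; push_cast; ring
  have hmono : √(n : ℝ) ≤ √((n + 1 : ℕ) : ℝ) := by gcongr; simp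
  rw [add_comm (√(m : ℝ)), add_comm (√(m : ℝ)), add_pow, add_pow, ← Finset.sum_sub_distrib,
    Finset.sum_range_succ', Finset.sum_range_succ', binomQuot, add_assoc, mul_add, Finset.mul_sum]
  refine le_add_of_le_of_nonneg (Finset.sum_le_sum fun r _ => ?_) ?_
  · have h := half_mul_pow_le_pow_sub_pow (Real.sqrt_nonneg n) (Real.sqrt_nonneg (n + 1 : ℕ)) hsq r
    have hc : ((m + 1).choose (r + 1 + 1) : ℝ) * (r + 2) = (m + 1) * m.choose (r + 1) := by
      have := Nat.add_one_mul_choose_eq m (r + 1)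
      have h2 : ((m : ℝ) + 1) * m.choose (r + 1) = (m + 1).choose (r + 1 + 1) * ((r : ℝ) + 1 + 1) := by
        exact_mod_cast this
      rw [h2]; ring
    have e : m + 1 - (r + 1 + 1) = m - (r + 1) := by omega
    rw [e]
    calc _ = 2 / ((m : ℝ) + 1) * ((((m + 1).choose (r + 1 + 1) : ℝ)) * √(m : ℝ) ^ (m - (r + 1)) *
            (((r : ℝ) + 2) / 2 * √(n : ℝ) ^ r)) := by
          field_simp
          linear_combination (-√(n : ℝ) ^ r) * hc
      _ ≤ 2 / ((m : ℝ) + 1) * ((((m + 1).choose (r + 1 + 1) : ℝ)) * √(m : ℝ) ^ (m - (r + 1)) *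
            (√((n + 1 : ℕ) : ℝ) ^ (r + 2) - √(n : ℝ) ^ (r + 2))) := by gcongr
      _ = _ := by ring
  · refine mul_nonneg (by positivity) (add_nonneg ?_ ?_) <;>
    · rw [sub_nonneg]
      gcongr

/-- The generalized entropy is monotone on positive vectors. -/
lemma genEntropy_le_of_le {m : ℕ} {z y : Fin m → ℝ} (hz : ∀ i, 0 < z i) (hzy : ∀ i, z i ≤ y i) :
    genEntropy z ≤ genEntropy y := by
  rcases Nat.eq_zero_or_pos m with rfl | hm
  · simp [genEntropy]
  have : Nonempty (Fin m) := ⟨⟨0, hm⟩⟩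
  have hy : ∀ i, 0 < y i := fun i => (hz i).trans_le (hzy i)
  set Z := ∑ i, z i with hZ
  set Y := ∑ i, y i with hY
  have hZ0 : 0 < Z := Finset.sum_pos (fun i _ => hz i) Finset.univ_nonempty
  have hY0 : 0 < Y := Finset.sum_pos (fun i _ => hy i) Finset.univ_nonempty
  have gZ : genEntropy z = ∑ i, (z i * Real.log Z - z i * Real.log (z i)) := by
    rw [Finset.sum_sub_distrib, ← Finset.sum_mul, genEntropy]; ring
  have gY : genEntropy y = ∑ i, y i * (Real.log Y - Real.log (y i)) := by
    simp_rw [mul_sub]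
    rw [Finset.sum_sub_distrib, ← Finset.sum_mul, genEntropy]; ring
  have gibbs : genEntropy z ≤ ∑ i, z i * (Real.log Y - Real.log (y i)) := by
    have h : ∑ i, (z i * Real.log Z - z i * Real.log (z i) - z i * (Real.log Y - Real.log (y i))) ≤
        ∑ i, (y i * Z / Y - z i) := by
      refine Finset.sum_le_sum fun i _ => ?_
      have hl := Real.log_le_sub_one_of_pos
        (show 0 < y i * Z / (Y * z i) from
          div_pos (mul_pos (hy i) hZ0) (mul_pos hY0 (hz i)))
      rw [Real.log_div (mul_pos (hy i) hZ0).ne' (mul_pos hY0 (hz i)).ne',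
        Real.log_mul (hy i).ne' hZ0.ne', Real.log_mul hY0.ne' (hz i).ne'] at hl
      have hm := mul_le_mul_of_nonneg_left hl (hz i).le
      have e : z i * (y i * Z / (Y * z i) - 1) = y i * Z / Y - z i := by
        have := (hz i).ne'
        field_simp
      rw [e] at hm
      linarith
    have h0 : ∑ i, (y i * Z / Y - z i) = 0 := by
      rw [Finset.sum_sub_distrib, ← Finset.sum_div, ← Finset.sum_mul, ← hY, ← hZ]
      field_simp
      ring
    rw [h0, Finset.sum_sub_distrib, ← gZ] at h
    linarith
  rw [gY]
  refine gibbs.trans (Finset.sum_le_sum fun i _ => ?_)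
  have : Real.log (y i) ≤ Real.log Y :=
    Real.log_le_log (hy i) (Finset.single_le_sum (fun j _ => (hy j).le) (Finset.mem_univ i))
  exact mul_le_mul_of_nonneg_right (hzy i) (by linarith)

lemma convexOn_mul_log_add_one_div :
    ConvexOn ℝ (Set.Ioi 0)
      (fun z : ℝ => z * (Real.log (z + 1) - Real.log z) + 1 / 2 * z⁻¹) := by
  have hd : ∀ z ∈ Set.Ioi (0 : ℝ), HasDerivAt
      (fun z : ℝ => z * (Real.log (z + 1) - Real.log z) + 1 / 2 * z⁻¹)
      (Real.log (z + 1) - Real.log z + z * ((z + 1)⁻¹ - z⁻¹) + 1 / 2 * -(z ^ 2)⁻¹) z := by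
    intro z hz
    have hz' : (0 : ℝ) < z := hz
    have h1 : HasDerivAt (fun z : ℝ => Real.log (z + 1)) (z + 1)⁻¹ z := by
      simpa using ((hasDerivAt_id z).add_const 1).log (by simp; positivity)
    have h := ((hasDerivAt_id z).mul (h1.sub (Real.hasDerivAt_log hz'.ne'))).add
      ((hasDerivAt_inv hz'.ne').const_mul (1 / 2))
    refine h.congr_deriv ?_
    simp
  have hd2 : ∀ z ∈ Set.Ioi (0 : ℝ), HasDerivAt
      (fun z : ℝ => Real.log (z + 1) - Real.log z + z * ((z + 1)⁻¹ - z⁻¹) + 1 / 2 * -(z ^ 2)⁻¹)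
      (1 / z ^ 3 - 1 / (z * (z + 1) ^ 2)) z := by
    intro z hz
    have hz' : (0 : ℝ) < z := hz
    have hz1 : z + 1 ≠ 0 := by positivity
    have h1 : HasDerivAt (fun z : ℝ => Real.log (z + 1)) (z + 1)⁻¹ z := by
      simpa using ((hasDerivAt_id z).add_const 1).log (by simp; positivity)
    have h2 : HasDerivAt (fun z : ℝ => (z + 1)⁻¹) (-1 / (z + 1) ^ 2) z := by
      simpa using ((hasDerivAt_id z).add_const 1).fun_inv (by simpa using hz1)
    have h3 : HasDerivAt (fun z : ℝ => (z ^ 2)⁻¹) (-(2 * z) / (z ^ 2) ^ 2) z := by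
      simpa using (hasDerivAt_pow 2 z).fun_inv (by positivity)
    have h := ((h1.sub (Real.hasDerivAt_log hz'.ne')).add
      ((hasDerivAt_id z).mul (h2.sub (hasDerivAt_inv hz'.ne')))).add (h3.neg.const_mul (1 / 2))
    refine h.congr_deriv ?_
    simp
    field_simp
    ring
  refine convexOn_of_hasDerivWithinAt2_nonneg (convex_Ioi 0)
    (fun z hz => (hd z hz).continuousAt.continuousWithinAt)
    (fun z hz => ?_) (fun z hz => ?_) (fun z hz => ?_) 
    (f' := fun z => Real.log (z + 1) - Real.log z + z * ((z + 1)⁻¹ - z⁻¹) + 1 / 2 * -(z ^ 2)⁻¹)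
    (f'' := fun z => 1 / z ^ 3 - 1 / (z * (z + 1) ^ 2))
  · rw [interior_Ioi] at hz
    exact (hd z hz).hasDerivWithinAt
  · rw [interior_Ioi] at hz
    exact (hd2 z hz).hasDerivWithinAt
  · rw [interior_Ioi] at hz
    have hz' : (0 : ℝ) < z := hz
    rw [sub_nonneg]
    have e : z ^ 3 = z * z ^ 2 := by ring
    rw [e]
    gcongr
    linarith

lemma genEntropy_sub_one_ge {m : ℕ} (hm : 1 ≤ m) {x : Fin m → ℝ} (hx : ∀ i, 1 < x i) :
    genEntropy x + ∑ i, Real.log (x i / ∑ j, x j) +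
        -(1 / 2) * ((∑ i, 1 / (x i - 1)) - m / ((∑ i, x i) / m - 1)) ≤
      genEntropy fun i => x i - 1 := by
  have : Nonempty (Fin m) := ⟨⟨0, hm⟩⟩
  have hm' : (0 : ℝ) < m := by exact_mod_cast hm
  have hz : ∀ i, 0 < x i - 1 := fun i => sub_pos.2 (hx i)
  have hx0 : ∀ i, 0 < x i := fun i => one_pos.trans (hx i)
  set s := ∑ i, x i with hs
  have hs0 : 0 < s := Finset.sum_pos (fun i _ => hx0 i) Finset.univ_nonempty
  have hZ : ∑ i, (x i - 1) = s - m := by simp [Finset.sum_sub_distrib, hs]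
  have hZ0 : 0 < s - m := hZ ▸ Finset.sum_pos (fun i _ => hz i) Finset.univ_nonempty
  have jensen := convexOn_mul_log_add_one_div.map_sum_le (t := Finset.univ)
    (w := fun _ : Fin m => (1 : ℝ) / m) (p := fun i => x i - 1) (fun _ _ => by positivity)
    (by simp; field_simp) (fun i _ => hz i)
  simp only [smul_eq_mul] at jensen
  rw [← Finset.mul_sum, ← Finset.mul_sum, hZ] at jensen
  have e1 : 1 / (m : ℝ) * (s - m) = (s - m) / m := by ring
  have e2 : (s - m) / m + 1 = s / m := by field_simp; ring
  rw [e1, e2, Real.log_div hs0.ne' hm'.ne', Real.log_div hZ0.ne' hm'.ne', one_div_mul_eq_div (m : ℝ),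
    le_div_iff₀ hm'] at jensen
  simp only [sub_add_cancel] at jensen
  rw [Finset.sum_add_distrib, ← Finset.mul_sum] at jensen
  have e3 : ((s - m) / m * (Real.log s - Real.log m - (Real.log (s - m) - Real.log m)) +
      1 / 2 * ((s - m) / m)⁻¹) * m = (s - m) * (Real.log s - Real.log (s - m)) +
      1 / 2 * (m / (s / m - 1)) := by
    have : s / m - 1 = (s - m) / m := by field_simp
    rw [this]
    field_simp
    ring
  rw [e3] at jensen
  have e4 : ∑ i, Real.log (x i / s) = ∑ i, Real.log (x i) - m * Real.log s := by
    simp_rw [fun i => Real.log_div (hx0 i).ne' hs0.ne']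
    simp [Finset.sum_sub_distrib]
  have e5 : ∑ i, (x i - 1) * (Real.log (x i) - Real.log (x i - 1)) =
      ∑ i, x i * Real.log (x i) - ∑ i, Real.log (x i) -
        ∑ i, (x i - 1) * Real.log (x i - 1) := by
    rw [← Finset.sum_sub_distrib, ← Finset.sum_sub_distrib]
    exact Finset.sum_congr rfl fun i _ => by ring
  rw [e5] at jensen
  rw [e4, genEntropy, genEntropy, hZ, ← hs]
  simp only [one_div] at jensen ⊢
  linarith

lemma multinomial_gt {m : ℕ} (hm : 1 ≤ m) {x : Fin m → ℝ} (hx : ∀ i, 1 < x i) {s : ℝ}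
    (hs : s = ∑ i, x i) {ν : Fin m → ℕ} (hsum : ∑ i, ν i = ⌈s⌉₊)
    (hclose : ∀ i, |(ν i : ℝ) - x i| ≤ 1) :
    √(2 * Real.pi) / √(2 * Real.pi) ^ m * Real.exp (-(m : ℝ) / 12) *
      ((√s * ∏ i, (x i / s) / √(x i + 1)) *
        Real.exp (-(1 / 2) * ((∑ i, 1 / (x i - 1)) - m / (s / m - 1)))) *
      Real.exp (genEntropy x) < Nat.multinomial Finset.univ ν := by
  have : Nonempty (Fin m) := ⟨⟨0, hm⟩⟩
  have hx0 : ∀ i, 0 < x i := fun i => one_pos.trans (hx i)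
  have hs0 : 0 < s := hs ▸ Finset.sum_pos (fun i _ => hx0 i) Finset.univ_nonempty
  have hlow : ∀ i, x i - 1 ≤ ν i := fun i => by linarith [(abs_le.1 (hclose i)).1]
  have hup : ∀ i, (ν i : ℝ) ≤ x i + 1 := fun i => by linarith [(abs_le.1 (hclose i)).2]
  have hν0 : ∀ i, ν i ≠ 0 := fun i h => by
    have := hlow i
    rw [h, Nat.cast_zero] at this
    linarith [hx i]
  have hG := (genEntropy_sub_one_ge hm hx).trans
    (genEntropy_le_of_le (fun i => sub_pos.2 (hx i)) hlow)
  rw [← hs] at hG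
  have hG' := Real.exp_le_exp.2 hG
  rw [Real.exp_add, Real.exp_add, Real.exp_sum] at hG'
  simp_rw [fun i => Real.exp_log (div_pos (hx0 i) hs0)] at hG'
  rw [multinomial_eq_mul_exp_genEntropy]
  have hnum : √(2 * Real.pi) * √s ≤ factorialQuot (∑ i, ν i) := by
    rw [← Real.sqrt_mul (by positivity)]
    refine le_trans ?_ (sqrt_le_factorialQuot _)
    gcongr
    rw [hsum]
    exact Nat.le_ceil s
  have hden : ∏ i, factorialQuot (ν i) <
      Real.exp ((m : ℝ) / 12) * (√(2 * Real.pi) ^ m * ∏ i, √(x i + 1)) := by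
    calc _ < ∏ i : Fin m, Real.exp (1 / 12) * (√(2 * Real.pi) * √(x i + 1)) := by
          refine Finset.prod_lt_prod_of_nonempty (fun i _ => factorialQuot_pos _) (fun i _ => ?_)
            Finset.univ_nonempty
          refine (factorialQuot_lt (hν0 i)).trans_le ?_
          rw [Real.sqrt_mul (by positivity)]
          gcongr
          exact hup i
      _ = _ := by
          rw [Finset.prod_mul_distrib, Finset.prod_mul_distrib]
          simp only [Finset.prod_const, Finset.card_univ, Fintype.card_fin]
          rw [← Real.exp_nat_mul]
          ring_nf
  have hprod : 0 < ∏ i, √(x i + 1) :=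
    Finset.prod_pos fun i _ => Real.sqrt_pos.2 (by linarith [hx0 i])
  have hdpos : 0 < ∏ i, factorialQuot (ν i) := Finset.prod_pos fun i _ => factorialQuot_pos _
  have hchi : 0 < ∏ i, x i / s := Finset.prod_pos fun i _ => div_pos (hx0 i) hs0
  rw [Finset.prod_div_distrib]
  have e : Real.exp (-(m : ℝ) / 12) = (Real.exp ((m : ℝ) / 12))⁻¹ := by
    rw [← Real.exp_neg]; ring_nf
  rw [e]
  calc _ = √(2 * Real.pi) * √s /
          (Real.exp ((m : ℝ) / 12) * (√(2 * Real.pi) ^ m * ∏ i, √(x i + 1))) *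
        (Real.exp (genEntropy x) * (∏ i, x i / s) *
          Real.exp (-(1 / 2) * ((∑ i, 1 / (x i - 1)) - m / (s / m - 1)))) := by
        field_simp
    _ < √(2 * Real.pi) * √s / (∏ i, factorialQuot (ν i)) *
        (Real.exp (genEntropy x) * (∏ i, x i / s) *
          Real.exp (-(1 / 2) * ((∑ i, 1 / (x i - 1)) - m / (s / m - 1)))) := by
        gcongr
    _ ≤ _ := by
        have := factorialQuot_pos (∑ i, ν i)
        gcongr

lemma sum_Ico_sum_multinomial_mul_exp_le {m : ℕ} (hm : 1 ≤ m) {a b : ℕ} (hab : a ≤ b + 1) :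
    ∑ n ∈ Finset.Ico a (b + 1), ∑ ν ∈ Finset.piAntidiag (Finset.univ : Finset (Fin m)) n,
        (Nat.multinomial Finset.univ ν : ℝ) * Real.exp (-genEntropy fun i => (ν i : ℝ)) ≤
      √(2 * Real.pi) * (1 / (√2 ^ m * Real.Gamma ((m : ℝ) / 2)) * (2 / (m + 1) *
        ((√(m : ℝ) + √((b + 1 : ℕ) : ℝ)) ^ (m + 1) - (√(m : ℝ) + √(a : ℝ)) ^ (m + 1)))) := by
  have hG : 0 < Real.Gamma ((m : ℝ) / 2) := Real.Gamma_pos_of_pos (by positivity)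
  calc _ ≤ ∑ n ∈ Finset.Ico a (b + 1), √(2 * Real.pi) *
          (1 / (√2 ^ m * Real.Gamma ((m : ℝ) / 2)) * (2 / (m + 1) *
            ((√(m : ℝ) + √((n + 1 : ℕ) : ℝ)) ^ (m + 1) - (√(m : ℝ) + √(n : ℝ)) ^ (m + 1)))) := by
        refine Finset.sum_le_sum fun n _ => (sum_multinomial_mul_exp_le hm n).trans ?_
        refine mul_le_mul_of_nonneg_left ?_ (Real.sqrt_nonneg _)
        exact mul_le_mul_of_nonneg_left (binomQuot_le m n) (by positivity)
    _ = _ := by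
        rw [← Finset.mul_sum, ← Finset.mul_sum, ← Finset.mul_sum,
          Finset.sum_Ico_sub (fun n : ℕ => (√(m : ℝ) + √(n : ℝ)) ^ (m + 1)) hab]

/-- A total number of realizations is controlled by an entropy bound and the range of sums. -/
lemma tsum_indicator_multinomial_le {m : ℕ} (hm : 1 ≤ m) {a b : ℕ} (hab : a ≤ b + 1) (E : ℝ)
    (B : Set (Fin m → ℕ))
    (hB : ∀ ν ∈ B, a ≤ ∑ i, ν i ∧ ∑ i, ν i ≤ b ∧ genEntropy (fun i => (ν i : ℝ)) ≤ E) :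
    ∑' ν : Fin m → ℕ, B.indicator (fun ν => (Nat.multinomial Finset.univ ν : ℝ)) ν ≤
      Real.exp E * (√(2 * Real.pi) * (1 / (√2 ^ m * Real.Gamma ((m : ℝ) / 2)) * (2 / (m + 1) *
        ((√(m : ℝ) + √((b + 1 : ℕ) : ℝ)) ^ (m + 1) - (√(m : ℝ) + √(a : ℝ)) ^ (m + 1))))) := by
  classical
  have hsupp : ∀ ν ∉ (Finset.Ico a (b + 1)).biUnion
      (Finset.piAntidiag (Finset.univ : Finset (Fin m))),
      B.indicator (fun ν => (Nat.multinomial Finset.univ ν : ℝ)) ν = 0 := by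
    intro ν hν
    apply Set.indicator_of_notMem
    intro h
    apply hν
    obtain ⟨h1, h2, -⟩ := hB ν h
    simp only [Finset.mem_biUnion, Finset.mem_Ico, Finset.mem_piAntidiag]
    exact ⟨_, ⟨h1, Nat.lt_succ_of_le h2⟩, rfl, fun _ _ => Finset.mem_univ _⟩
  rw [tsum_eq_sum hsupp, Finset.sum_biUnion]
  · refine le_trans ?_ (mul_le_mul_of_nonneg_left (sum_Ico_sum_multinomial_mul_exp_le hm hab)
      (Real.exp_pos E).le)
    rw [Finset.mul_sum]
    refine Finset.sum_le_sum fun n _ => ?_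
    rw [Finset.mul_sum]
    refine Finset.sum_le_sum fun ν _ => ?_
    by_cases hν : ν ∈ B
    · rw [Set.indicator_of_mem hν, mul_left_comm, ← Real.exp_add]
      refine le_mul_of_one_le_right (Nat.cast_nonneg _) (Real.one_le_exp ?_)
      linarith [(hB ν hν).2.2]
    · rw [Set.indicator_of_notMem hν]
      positivity
  · intro i _ j _ hij
    rw [Function.onFun, Finset.disjoint_left]
    intro ν hi hj
    rw [Finset.mem_piAntidiag] at hi hj
    exact hij (hi.1.symm.trans hj.1)

/-- Concentration w.r.t. entropy difference (Theorem `Gdiff`): the number of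
realizations `#ν*` of the MaxGEnt count vector exceeds
`((m+1)e^{−m/12}Γ(m/2)/(2π^{m/2})) (C₂C₄/C₃) e^{ηG*}` times the total number of
realizations of all count vectors `ν` with `n₁ ≤ ∑ᵢνᵢ ≤ n₂` satisfying the
`δ`-relaxed constraints and `G(ν) < (1−η)G*`. -/
theorem stmt13 {m p q : ℕ} (hm : 1 ≤ m)
    (AE : Matrix (Fin p) (Fin m) ℝ) (bE : Fin p → ℝ) (hbE : ∀ i, bE i ≠ 0)
    (AI : Matrix (Fin q) (Fin m) ℝ) (bI : Fin q → ℝ) (hbI : ∀ i, bI i ≠ 0)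
    (C : Set (Fin m → ℝ))
    (hC : C = {x | AE.mulVec x = bE ∧ (∀ j, AI.mulVec x j ≤ bI j) ∧ ∀ i, 0 ≤ x i})
    (hne : C.Nonempty) (hbd : Bornology.IsBounded C)
    (xs : Fin m → ℝ) (hxsC : xs ∈ C)
    (hmax : ∀ x ∈ C, genEntropy x ≤ genEntropy xs)
    (hx1 : ∀ i, 1 < xs i)
    (Gs ss : ℝ) (hGs : Gs = genEntropy xs) (hss : ss = ∑ i, xs i)
    (s1 s2 : ℝ)
    (hs1 : IsLeast ((fun x => ∑ i, x i) '' C) s1)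
    (hs2 : IsGreatest ((fun x => ∑ i, x i) '' C) s2)
    (n1 n2 : ℕ) (hn1 : n1 = ⌈s1⌉₊) (hn2 : n2 = ⌈s2⌉₊)
    (νs : Fin m → ℕ) (hνsum : (∑ i, νs i) = ⌈ss⌉₊)
    (hνclose : ∀ i, |(νs i : ℝ) - xs i| ≤ 1)
    (δ η : ℝ) (hδ : 0 < δ) (hη : 0 < η) :
    (Nat.multinomial Finset.univ νs : ℝ) >
      (((m : ℝ) + 1) * Real.exp (-(m : ℝ) / 12) * Real.Gamma ((m : ℝ) / 2) /
          (2 * Real.pi ^ ((m : ℝ) / 2))) *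
      ((Real.sqrt ss * ∏ i, (xs i / ss) / Real.sqrt (xs i + 1)) *
          Real.exp (-(1 / 2) * ((∑ i, 1 / (xs i - 1)) - m / (ss / m - 1))) /
          ((Real.sqrt m + Real.sqrt (s2 + 2)) ^ (m + 1) -
            (Real.sqrt m + Real.sqrt s1) ^ (m + 1))) *
      Real.exp (η * Gs) *
      (∑' ν : Fin m → ℕ,
        Set.indicator
          {ν : Fin m → ℕ |
            n1 ≤ ∑ i, ν i ∧ (∑ i, ν i) ≤ n2 ∧
            (∀ i, bE i - δ * |bE i| ≤ AE.mulVec (fun j => (ν j : ℝ)) i ∧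
                  AE.mulVec (fun j => (ν j : ℝ)) i ≤ bE i + δ * |bE i|) ∧
            (∀ i, AI.mulVec (fun j => (ν j : ℝ)) i ≤ bI i + δ * |bI i|) ∧
            genEntropy (fun i => (ν i : ℝ)) < (1 - η) * Gs}
          (fun ν => (Nat.multinomial Finset.univ ν : ℝ)) ν) := by
  subst hGs
  have hx0 : ∀ i, 0 < xs i := fun i => one_pos.trans (hx1 i)
  have hC0 : ∀ x ∈ C, 0 ≤ ∑ i, x i := by
    rintro x hx
    rw [hC] at hx
    exact Finset.sum_nonneg fun i _ => hx.2.2 i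
  obtain ⟨y, hyC, hy⟩ := hs2.1
  have hs20 : 0 ≤ s2 := hy ▸ hC0 y hyC
  have hs12 : s1 ≤ s2 := hs1.2 hs2.1
  have hn12 : n1 ≤ n2 := hn1 ▸ hn2 ▸ Nat.ceil_mono hs12
  have hle1 : s1 ≤ n1 := hn1 ▸ Nat.le_ceil s1
  have hle2 : ((n2 + 1 : ℕ) : ℝ) ≤ s2 + 2 := by
    have := (Nat.ceil_lt_add_one hs20).le
    push_cast
    rw [hn2]
    linarith
  have hG : 0 < Real.Gamma ((m : ℝ) / 2) := Real.Gamma_pos_of_pos (by positivity)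
  have hC3 : 0 < (√(m : ℝ) + √(s2 + 2)) ^ (m + 1) - (√(m : ℝ) + √s1) ^ (m + 1) := by
    rw [sub_pos]
    have : √s1 < √(s2 + 2) := Real.sqrt_lt_sqrt_iff_of_pos (by linarith) |>.2 (by linarith)
    gcongr
  have hs0 : 0 ≤ ss := hss ▸ Finset.sum_nonneg fun i _ => (hx0 i).le
  have hprod : 0 ≤ ∏ i, (xs i / ss) / √(xs i + 1) := Finset.prod_nonneg fun i _ =>
    div_nonneg (div_nonneg (hx0 i).le hs0) (Real.sqrt_nonneg _)
  refine lt_of_le_of_lt ?_ (multinomial_gt hm hx1 hss hνsum hνclose)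
  refine (mul_le_mul_of_nonneg_left (tsum_indicator_multinomial_le hm (hn12.trans (Nat.le_succ _))
    ((1 - η) * genEntropy xs) _ fun ν hν => ⟨hν.1, hν.2.1, hν.2.2.2.2.le⟩) ?_).trans ?_
  · positivity
  have hF : (√(m : ℝ) + √((n2 + 1 : ℕ) : ℝ)) ^ (m + 1) - (√(m : ℝ) + √(n1 : ℝ)) ^ (m + 1) ≤
      (√(m : ℝ) + √(s2 + 2)) ^ (m + 1) - (√(m : ℝ) + √s1) ^ (m + 1) := by
    gcongr
  have hpi : Real.pi ^ ((m : ℝ) / 2) = √Real.pi ^ m := by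
    rw [Real.sqrt_eq_rpow, ← Real.rpow_mul_natCast Real.pi_pos.le]
    ring_nf
  have hexp : Real.exp (genEntropy xs) =
      Real.exp (η * genEntropy xs) * Real.exp ((1 - η) * genEntropy xs) := by
    rw [← Real.exp_add]; ring_nf
  rw [hpi, hexp, Real.sqrt_mul zero_le_two, mul_pow]
  set P := √ss * ∏ i, (xs i / ss) / √(xs i + 1) with hP
  have hP0 : 0 ≤ P := mul_nonneg (Real.sqrt_nonneg _) hprod
  set D := (√(m : ℝ) + √(s2 + 2)) ^ (m + 1) - (√(m : ℝ) + √s1) ^ (m + 1) with hD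
  set D' := (√(m : ℝ) + √((n2 + 1 : ℕ) : ℝ)) ^ (m + 1) - (√(m : ℝ) + √(n1 : ℝ)) ^ (m + 1) with hD'
  set Q := Real.exp (-(1 / 2) * ((∑ i, 1 / (xs i - 1)) - m / (ss / m - 1))) with hQ
  have hQ0 : 0 < Q := Real.exp_pos _
  calc _ = D' / D * (√2 * √Real.pi / (√2 ^ m * √Real.pi ^ m) * Real.exp (-(m : ℝ) / 12) * (P * Q) *
          (Real.exp (η * genEntropy xs) * Real.exp ((1 - η) * genEntropy xs))) := by
        field_simp
    _ ≤ _ := mul_le_of_le_one_left (by positivity) ((div_le_one hC3).2 hF)
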